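/- arXiv:1710.05368 — 7 statements merged into one kernel-verified Lean document; each statement's English description precedes it below -/
import Mathlib

section
/- Let C be a cut in an occurrence net N and let t be a transition enabled in C. Then C' := C − pre(t) + post(t) is also a cut; in particular, C' is a set and C' = (C \ pre(t)) ∪ post(t). -/
/-- A Petri net over places `P` and transitions `T`: each transition has a
nonempty finite multiset precondition and postcondition (encoding the flow
relation `F`), and there is a finite initial marking. -/
structure PetriNet (P T : Type) where
  pre  : T → Multiset P
  post : T → Multiset P
  init : Multiset P
  pre_ne  : ∀ t, pre t ≠ 0
  post_ne : ∀ t, post t ≠ 0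

namespace PetriNet

variable {P T : Type}

/-- A transition `t` is enabled in a marking `M` if `pre t ⊆ M`. -/
def Enabled (N : PetriNet P T) (M : Multiset P) (t : T) : Prop :=
  N.pre t ≤ M

/-- `M →t M'`: firing an enabled transition. -/
def Fires [DecidableEq P] (N : PetriNet P T) (M : Multiset P) (t : T) (M' : Multiset P) : Prop :=
  N.pre t ≤ M ∧ M' = M - N.pre t + N.post t

def Step [DecidableEq P] (N : PetriNet P T) (M M' : Multiset P) : Prop :=
  ∃ t, N.Fires M t M'

/-- A marking is reachable if obtained from the initial marking by firing a
finite sequence of transitions. -/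
def Reachable [DecidableEq P] (N : PetriNet P T) (M : Multiset P) : Prop :=
  Relation.ReflTransGen N.Step N.init M

/-- The flow relation on nodes (places ⊕ transitions). -/
def Flow (N : PetriNet P T) : P ⊕ T → P ⊕ T → Prop
  | Sum.inl p, Sum.inr t => p ∈ N.pre t
  | Sum.inr t, Sum.inl p => p ∈ N.post t
  | _, _ => False

/-- `<` : transitive closure of the flow relation. -/
def CLt (N : PetriNet P T) : P ⊕ T → P ⊕ T → Prop := Relation.TransGen N.Flow

/-- `≤` : reflexive-transitive closure of the flow relation. -/
def CLe (N : PetriNet P T) : P ⊕ T → P ⊕ T → Prop := Relation.ReflTransGen N.Flow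

/-- Nodes `x`, `y` are in conflict if from some place `q` (distinct from both)
one can reach `x` and `y` via two different outgoing transitions of `q`. -/
def Conflict (N : PetriNet P T) (x y : P ⊕ T) : Prop :=
  ∃ q : P, Sum.inl q ≠ x ∧ Sum.inl q ≠ y ∧
    ∃ t₁ t₂ : T, t₁ ≠ t₂ ∧ q ∈ N.pre t₁ ∧ q ∈ N.pre t₂ ∧
      N.CLe (Sum.inr t₁) x ∧ N.CLe (Sum.inr t₂) y

/-- Concurrent: neither causally related nor in conflict. -/
def Concurrent (N : PetriNet P T) (x y : P ⊕ T) : Prop :=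
  ¬ N.CLe x y ∧ ¬ N.CLe y x ∧ ¬ N.Conflict x y

/-- Occurrence net: pre/postconditions are sets, every place has at most one
incoming transition, the initial marking is the set of places without incoming
transitions, the inverse flow relation is well-founded, and no transition is in
self-conflict. -/
structure IsOccurrence (N : PetriNet P T) : Prop where
  pre_nodup : ∀ t, (N.pre t).Nodup
  post_nodup : ∀ t, (N.post t).Nodup
  unique_pre : ∀ p : P, ∀ t₁ t₂ : T, p ∈ N.post t₁ → p ∈ N.post t₂ → t₁ = t₂
  init_nodup : N.init.Nodup
  mem_init : ∀ p : P, p ∈ N.init ↔ ∀ t : T, p ∉ N.post t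
  wf : WellFounded N.Flow
  no_self_conflict : ∀ t : T, ¬ N.Conflict (Sum.inr t) (Sum.inr t)

def PairwiseConcurrent (N : PetriNet P T) (C : Set P) : Prop :=
  ∀ p ∈ C, ∀ q ∈ C, p ≠ q → N.Concurrent (Sum.inl p) (Sum.inl q)

/-- A cut: a maximal set of pairwise concurrent places. -/
def IsCut (N : PetriNet P T) (C : Set P) : Prop :=
  N.PairwiseConcurrent C ∧ ∀ D : Set P, N.PairwiseConcurrent D → C ⊆ D → D = C

end PetriNet

/-- `(N₁, fP, fT)` is an initial branching process of `N₂`: `N₁` is an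
occurrence net, `(fP, fT)` is an initial homomorphism, and transitions with the
same precondition and the same image coincide. -/
structure IsBranchingProcess {P₁ T₁ P₂ T₂ : Type}
    (N₁ : PetriNet P₁ T₁) (N₂ : PetriNet P₂ T₂)
    (fP : P₁ → P₂) (fT : T₁ → T₂) : Prop where
  occ : N₁.IsOccurrence
  map_pre : ∀ t, (N₁.pre t).map fP = N₂.pre (fT t)
  map_post : ∀ t, (N₁.post t).map fP = N₂.post (fT t)
  map_init : N₁.init.map fP = N₂.init
  trans_inj : ∀ t₁ t₂, N₁.pre t₁ = N₁.pre t₂ → fT t₁ = fT t₂ → t₁ = t₂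


namespace PetriNet

variable {P T : Type} {N : PetriNet P T}

theorem Conflict.symm {x y : P ⊕ T} (h : N.Conflict x y) : N.Conflict y x := by
  obtain ⟨q, hx, hy, t₁, t₂, hne, h₁, h₂, hc₁, hc₂⟩ := h
  exact ⟨q, hy, hx, t₂, t₁, hne.symm, h₂, h₁, hc₂, hc₁⟩

theorem Concurrent.symm {x y : P ⊕ T} (h : N.Concurrent x y) : N.Concurrent y x :=
  ⟨h.2.1, h.1, fun hc => h.2.2 hc.symm⟩

theorem flow_pre {p : P} {t : T} (h : p ∈ N.pre t) : N.Flow (Sum.inl p) (Sum.inr t) := h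

theorem flow_post {p : P} {t : T} (h : p ∈ N.post t) : N.Flow (Sum.inr t) (Sum.inl p) := h

theorem clt_of_mem_pre_of_mem_post {p q : P} {t : T} (hp : p ∈ N.pre t) (hq : q ∈ N.post t) :
    N.CLt (Sum.inl p) (Sum.inl q) :=
  (Relation.TransGen.single (flow_pre hp)).tail (flow_post hq)

theorem eq_or_exists_pre_of_cle {x : P ⊕ T} {t : T} (h : N.CLe x (Sum.inr t)) :
    x = Sum.inr t ∨ ∃ r ∈ N.pre t, N.CLe x (Sum.inl r) := by
  rcases Relation.ReflTransGen.cases_tail h with h | ⟨y, hxy, hy⟩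
  · exact Or.inl h.symm
  · cases y with
    | inl r => exact Or.inr ⟨r, hy, hxy⟩
    | inr u => exact hy.elim

theorem eq_or_exists_pre_of_cle_place {x : P ⊕ T} {p : P} (h : N.CLe x (Sum.inl p)) :
    x = Sum.inl p ∨ ∃ t, p ∈ N.post t ∧ N.CLe x (Sum.inr t) := by
  rcases Relation.ReflTransGen.cases_tail h with h | ⟨y, hxy, hy⟩
  · exact Or.inl h.symm
  · cases y with
    | inl r => exact hy.elim
    | inr u => exact Or.inr ⟨u, hy, hxy⟩

theorem eq_or_exists_post_of_place_cle {x : P ⊕ T} {p : P} (h : N.CLe (Sum.inl p) x) :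
    x = Sum.inl p ∨ ∃ t, p ∈ N.pre t ∧ N.CLe (Sum.inr t) x := by
  rcases Relation.ReflTransGen.cases_head h with h | ⟨y, hy, hyx⟩
  · exact Or.inl h.symm
  · cases y with
    | inl r => exact hy.elim
    | inr u => exact Or.inr ⟨u, hy, hyx⟩

theorem exists_post_of_transition_cle {p : P} {t : T} (h : N.CLe (Sum.inr t) (Sum.inl p)) :
    ∃ q ∈ N.post t, N.CLe (Sum.inl q) (Sum.inl p) := by
  rcases Relation.ReflTransGen.cases_head h with h | ⟨y, hy, hyx⟩
  · cases h
  · cases y with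
    | inl r => exact ⟨r, hy, hyx⟩
    | inr u => exact hy.elim

namespace IsOccurrence

theorem not_clt_self (hN : N.IsOccurrence) (x : P ⊕ T) : ¬ N.CLt x x :=
  fun h => hN.wf.transGen.irrefl.irrefl x h

theorem ne_of_clt (hN : N.IsOccurrence) {x y : P ⊕ T} (h : N.CLt x y) : x ≠ y := by
  rintro rfl
  exact hN.not_clt_self x h

theorem cle_of_cle_post (hN : N.IsOccurrence) {x : P ⊕ T} {p : P} {t : T}
    (hp : p ∈ N.post t) (h : N.CLe x (Sum.inl p)) (hne : x ≠ Sum.inl p) :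
    N.CLe x (Sum.inr t) := by
  rcases eq_or_exists_pre_of_cle_place h with h | ⟨u, hu, hxu⟩
  · exact (hne h).elim
  · rwa [hN.unique_pre p t u hp hu]

/-- Distinct places in the postcondition of a transition are concurrent. -/
theorem concurrent_post (hN : N.IsOccurrence) {t : T} {p q : P} (hp : p ∈ N.post t)
    (hq : q ∈ N.post t) (hne : p ≠ q) : N.Concurrent (Sum.inl p) (Sum.inl q) := by
  have not_cle : ∀ {a b : P}, a ∈ N.post t → b ∈ N.post t → a ≠ b →
      ¬ N.CLe (Sum.inl a) (Sum.inl b) := fun ha hb hab h =>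
    hN.not_clt_self _ (Relation.TransGen.head' (flow_post ha)
      (hN.cle_of_cle_post hb h (by simpa using hab)))
  refine ⟨not_cle hp hq hne, not_cle hq hp hne.symm, ?_⟩
  rintro ⟨s, -, -, t₁, t₂, h12, h₁, h₂, hc₁, hc₂⟩
  exact hN.no_self_conflict t ⟨s, by simp, by simp, t₁, t₂, h12, h₁, h₂,
    hN.cle_of_cle_post hp hc₁ (by simp), hN.cle_of_cle_post hq hc₂ (by simp)⟩

/-- A place concurrent to the whole precondition of a transition is concurrent to its
postcondition. -/
theorem concurrent_post_of_forall_pre (hN : N.IsOccurrence) {t : T} {p q : P}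
    (hp : ∀ r ∈ N.pre t, N.Concurrent (Sum.inl p) (Sum.inl r)) (hq : q ∈ N.post t) :
    N.Concurrent (Sum.inl p) (Sum.inl q) := by
  obtain ⟨r₀, hr₀⟩ := Multiset.exists_mem_of_ne_zero (N.pre_ne t)
  have not_cle : ¬ N.CLe (Sum.inl q) (Sum.inl p) := fun h =>
    (hp r₀ hr₀).2.1 ((clt_of_mem_pre_of_mem_post hr₀ hq).to_reflTransGen.trans h)
  refine ⟨fun h => ?_, not_cle, ?_⟩
  · by_cases hpq : p = q
    · subst hpq
      exact not_cle h
    · rcases eq_or_exists_pre_of_cle (hN.cle_of_cle_post hq h (by simpa using hpq)) with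
        h | ⟨r, hr, hpr⟩
      · cases h
      · exact (hp r hr).1 hpr
  · rintro ⟨s, hsp, -, t₁, t₂, h12, h₁, h₂, hc₁, hc₂⟩
    rcases eq_or_exists_pre_of_cle (hN.cle_of_cle_post hq hc₂ (by simp)) with h | ⟨r, hr, hc⟩
    · cases h
      exact (hp s h₂).2.1 (hc₁.head (flow_pre h₁))
    · exact (hp r hr).2.2 ⟨s, hsp, hN.ne_of_clt (Relation.TransGen.head' (flow_pre h₂) hc),
        t₁, t₂, h12, h₁, h₂, hc₁, hc⟩

/-- A place concurrent to the whole postcondition of a transition is concurrent to every other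
place in its precondition. -/
theorem concurrent_pre_of_forall_post (hN : N.IsOccurrence) {t : T} {p r : P}
    (hp : ∀ q ∈ N.post t, N.Concurrent (Sum.inl p) (Sum.inl q)) (hr : r ∈ N.pre t)
    (hne : p ≠ r) : N.Concurrent (Sum.inl p) (Sum.inl r) := by
  obtain ⟨q, hq⟩ := Multiset.exists_mem_of_ne_zero (N.post_ne t)
  have hrq := clt_of_mem_pre_of_mem_post hr hq
  refine ⟨fun h => (hp q hq).1 (h.trans hrq.to_reflTransGen), fun h => ?_, ?_⟩
  · rcases eq_or_exists_post_of_place_cle h with h | ⟨u, hu, hup⟩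
    · exact hne (by simpa using h)
    · by_cases hut : u = t
      · subst hut
        obtain ⟨q', hq', hc⟩ := exists_post_of_transition_cle hup
        exact (hp q' hq').2.1 hc
      · exact (hp q hq).2.2 ⟨r, by simpa using hne.symm, hN.ne_of_clt hrq, u, t, hut, hu, hr, hup,
          Relation.ReflTransGen.single (flow_post hq)⟩
  · rintro ⟨s, hsp, -, t₁, t₂, h12, h₁, h₂, hc₁, hc₂⟩
    have hc := hc₂.trans hrq.to_reflTransGen
    exact (hp q hq).2.2 ⟨s, hsp, hN.ne_of_clt (Relation.TransGen.head' (flow_pre h₂) hc),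
      t₁, t₂, h12, h₁, h₂, hc₁, hc⟩

end IsOccurrence

end PetriNet

/-- Let `C` be a cut in an occurrence net in which `t` is enabled. Then
`C' = (C \\ pre(t)) ∪ post(t)` is also a cut; in particular `C'` is a set,
i.e. `C − pre(t) + post(t)` adds no duplicates: `post(t)` is disjoint from
`C \\ pre(t)`. -/
theorem cut_fire_cut {P T : Type} (N : PetriNet P T) (hN : N.IsOccurrence)
    (C : Set P) (hC : N.IsCut C) (t : T) (ht : ∀ p ∈ N.pre t, p ∈ C) :
    N.IsCut ((C \ {p : P | p ∈ N.pre t}) ∪ {p : P | p ∈ N.post t}) ∧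
      ∀ p ∈ N.post t, p ∉ C \ {p : P | p ∈ N.pre t} := by
  obtain ⟨hCo, hmax⟩ := hC
  have hold : ∀ p ∈ C \ {p : P | p ∈ N.pre t}, ∀ q ∈ N.post t,
      N.Concurrent (Sum.inl p) (Sum.inl q) := fun p hp q hq =>
    hN.concurrent_post_of_forall_pre (fun r hr => hCo p hp.1 r (ht r hr) (by
      rintro rfl
      exact hp.2 hr)) hq
  refine ⟨⟨?_, fun D hD hCD => Set.Subset.antisymm (fun x hx => ?_) hCD⟩,
    fun p hp hpC => (hold p hpC p hp).1 Relation.ReflTransGen.refl⟩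
  · rintro p (hp | hp) q (hq | hq) hne
    · exact hCo p hp.1 q hq.1 hne
    · exact hold p hp q hq
    · exact (hold q hq p hp).symm
    · exact hN.concurrent_post hp hq hne
  · by_contra hxC
    have hpost : ∀ q ∈ N.post t, N.Concurrent (Sum.inl x) (Sum.inl q) := fun q hq =>
      hD x hx q (hCD (Or.inr hq)) (by
        rintro rfl
        exact hxC (Or.inr hq))
    have hco : ∀ r ∈ C, x ≠ r → N.Concurrent (Sum.inl x) (Sum.inl r) := fun r hr hne => by
      by_cases hrt : r ∈ N.pre t
      · exact hN.concurrent_pre_of_forall_post hpost hrt hne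
      · exact hD x hx r (hCD (Or.inl ⟨hr, hrt⟩)) hne
    have hins : N.PairwiseConcurrent (insert x C) := by
      rintro p (rfl | hp) q (rfl | hq) hne
      · exact (hne rfl).elim
      · exact hco q hq hne
      · exact (hco p hp hne.symm).symm
      · exact hCo p hp q hq hne
    have hxmem : x ∈ C := hmax _ hins (Set.subset_insert x C) ▸ Set.mem_insert x C
    have hxt : x ∈ N.pre t := by
      by_contra h
      exact hxC (Or.inl ⟨hxmem, h⟩)
    obtain ⟨q, hq⟩ := Multiset.exists_mem_of_ne_zero (N.post_ne t)
    exact (hpost q hq).1 (PetriNet.clt_of_mem_pre_of_mem_post hxt hq).to_reflTransGen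
end

section
/- Every occurrence net is 1-bounded; that is, every reachable marking M of an occurrence net satisfies M(p) ≤ 1 for all places p (equivalently, every reachable marking is a set). -/
namespace PetriNet

variable {P T : Type}

/-- The marking equation: a reachable marking is determined by the multiset of fired
transitions. -/
theorem Reachable.exists_marking_eq [DecidableEq P] {N : PetriNet P T} {M : Multiset P}
    (hM : N.Reachable M) : ∃ S : Multiset T, M + S.bind N.pre = N.init + S.bind N.post := by
  induction hM with
  | refl => exact ⟨0, by simp⟩
  | tail _ hstep ih =>
    obtain ⟨S, hS⟩ := ih
    obtain ⟨t, hle, rfl⟩ := hstep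
    refine ⟨t ::ₘ S, ?_⟩
    obtain ⟨R, rfl⟩ := Multiset.le_iff_exists_add.1 hle
    rw [add_tsub_cancel_left, Multiset.cons_bind, Multiset.cons_bind, add_left_comm N.init, ← hS]
    abel

theorem count_le_count_bind [DecidableEq P] [DecidableEq T] (f : T → Multiset P) {p : P} {t : T}
    (hp : p ∈ f t) (S : Multiset T) : S.count t ≤ (S.bind f).count p := by
  induction S using Multiset.induction_on with
  | empty => simp
  | cons a S ih =>
    rw [Multiset.cons_bind, Multiset.count_add, Multiset.count_cons]
    split_ifs with h
    · subst h
      have := Multiset.one_le_count_iff_mem.2 hp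
      omega
    · omega

namespace IsOccurrence

variable {N : PetriNet P T}

theorem count_bind_post_le [DecidableEq P] [DecidableEq T] (hN : N.IsOccurrence) {p : P} {t : T}
    (hp : p ∈ N.post t) (S : Multiset T) : (S.bind N.post).count p ≤ S.count t := by
  induction S using Multiset.induction_on with
  | empty => simp
  | cons a S ih =>
    rw [Multiset.cons_bind, Multiset.count_add, Multiset.count_cons]
    split_ifs with h
    · have := Multiset.nodup_iff_count_le_one.1 (hN.post_nodup a) p
      omega
    · have : (N.post a).count p = 0 :=
        Multiset.count_eq_zero.2 fun ha => h (hN.unique_pre p t a hp ha)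
      omega

/-- If every transition producing a token on `p` is fired at most once, then `p` receives at most
one token in total, counting the initial one. -/
theorem count_init_add_bind_post_le_one [DecidableEq P] [DecidableEq T] (hN : N.IsOccurrence)
    {S : Multiset T} {p : P} (hS : ∀ t, p ∈ N.post t → S.count t ≤ 1) :
    (N.init + S.bind N.post).count p ≤ 1 := by
  rw [Multiset.count_add]
  by_cases h : ∃ t, p ∈ N.post t
  · obtain ⟨t, ht⟩ := h
    have hinit : N.init.count p = 0 :=
      Multiset.count_eq_zero.2 fun hp => (hN.mem_init p).1 hp t ht
    have := hN.count_bind_post_le ht S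
    have := hS t ht
    omega
  · have hbind : (S.bind N.post).count p = 0 :=
      Multiset.count_eq_zero.2 fun hp => by
        obtain ⟨t, -, ht⟩ := Multiset.mem_bind.1 hp
        exact h ⟨t, ht⟩
    have := Multiset.nodup_iff_count_le_one.1 hN.init_nodup p
    omega

theorem count_fired_le_one [DecidableEq P] [DecidableEq T] (hN : N.IsOccurrence)
    {M : Multiset P} {S : Multiset T} (hS : M + S.bind N.pre = N.init + S.bind N.post) (t : T) :
    S.count t ≤ 1 := by
  suffices H : ∀ x : P ⊕ T, Sum.elim (fun p => (N.init + S.bind N.post).count p ≤ 1)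
      (fun t => S.count t ≤ 1) x from H (Sum.inr t)
  intro x
  induction x using hN.wf.induction with
  | _ x ih =>
    rcases x with p | t
    · exact hN.count_init_add_bind_post_le_one fun t ht => ih (Sum.inr t) ht
    · obtain ⟨p, hp⟩ := Multiset.exists_mem_of_ne_zero (N.pre_ne t)
      have hp_le : (N.init + S.bind N.post).count p ≤ 1 := ih (Sum.inl p) hp
      rw [← hS, Multiset.count_add] at hp_le
      have := count_le_count_bind N.pre hp S
      show S.count t ≤ 1
      omega

end IsOccurrence

end PetriNet

/-- Every occurrence net is 1-bounded: every reachable marking has at most one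
token on each place. -/
theorem occurrence_one_bounded {P T : Type} [DecidableEq P] (N : PetriNet P T)
    (hN : N.IsOccurrence) (M : Multiset P) (hM : N.Reachable M) (p : P) :
    M.count p ≤ 1 := by
  classical
  obtain ⟨S, hS⟩ := hM.exists_marking_eq
  have h := hN.count_init_add_bind_post_le_one (p := p) fun t _ => hN.count_fired_le_one hS t
  rw [← hS, Multiset.count_add] at h
  omega
end

section
/- For every occurrence net N and every place p of N, the causal past past(p) is finite. -/
/-- A well-founded relation in which every point has finitely many immediate predecessors has
finite sets of predecessors along its reflexive-transitive closure. -/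
theorem WellFounded.finite_setOf_reflTransGen {α : Type*} {r : α → α → Prop}
    (hwf : WellFounded r) (hfin : ∀ x, {y | r y x}.Finite) (x : α) :
    {y | Relation.ReflTransGen r y x}.Finite := by
  induction x using hwf.induction with
  | _ x ih =>
    refine (((hfin x).biUnion ih).insert x).subset fun y hy => ?_
    rcases Relation.ReflTransGen.cases_tail hy with h | ⟨z, hyz, hzx⟩
    · exact Or.inl h.symm
    · exact Or.inr (Set.mem_biUnion hzx hyz)

theorem PetriNet.IsOccurrence.finite_setOf_flow {P T : Type} {N : PetriNet P T}
    (hN : N.IsOccurrence) (x : P ⊕ T) : {y | N.Flow y x}.Finite := by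
  classical
  rcases x with p | t
  · refine Set.Subsingleton.finite ?_
    rintro (q | s) hs (q' | s') hs'
    · exact hs.elim
    · exact hs.elim
    · exact hs'.elim
    · exact congrArg Sum.inr (hN.unique_pre p s s' hs hs')
  · refine ((N.pre t).toFinset.finite_toSet.image Sum.inl).subset ?_
    rintro (q | s) h
    · exact ⟨q, Multiset.mem_toFinset.mpr h, rfl⟩
    · exact h.elim

/-- In an occurrence net, the causal past of every place is finite. -/
theorem finite_past {P T : Type} (N : PetriNet P T) (hN : N.IsOccurrence) (p : P) :
    {y : P ⊕ T | N.CLe y (Sum.inl p)}.Finite :=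
  hN.wf.finite_setOf_reflTransGen hN.finite_setOf_flow (Sum.inl p)
end

section
/- Let N be an occurrence net and S a finite set of pairwise concurrent places of N. Then there is a reachable marking M of N such that S ⊆ M. -/
namespace PetriNet

variable {P T : Type} {N : PetriNet P T}

namespace IsOccurrence

theorem not_cLe_of_flow (hN : N.IsOccurrence) {x y : P ⊕ T} (hxy : N.Flow x y) : ¬ N.CLe y x :=
  fun hyx => hN.wf.transGen.irrefl.irrefl x (Relation.TransGen.head' hxy hyx)

theorem finite_setOf_flow_s8 (hN : N.IsOccurrence) (x : P ⊕ T) : {y | N.Flow y x}.Finite := by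
  classical
  rcases x with p | t
  · refine Set.Subsingleton.finite ?_
    rintro (q | t₁) h₁ (r | t₂) h₂
    · exact h₁.elim
    · exact h₁.elim
    · exact h₂.elim
    · exact congrArg Sum.inr (hN.unique_pre p t₁ t₂ h₁ h₂)
  · refine ((N.pre t).toFinset.finite_toSet.image Sum.inl).subset ?_
    rintro (p | t') h
    · exact ⟨p, Multiset.mem_toFinset.2 h, rfl⟩
    · exact h.elim

theorem finite_setOf_cLe (hN : N.IsOccurrence) (x : P ⊕ T) : {y | N.CLe y x}.Finite := by
  induction x using hN.wf.induction with
  | _ x ih =>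
    refine ((Set.finite_singleton x).union ((hN.finite_setOf_flow_s8 x).biUnion ih)).subset ?_
    intro y hy
    rcases Relation.ReflTransGen.cases_tail hy with rfl | ⟨z, hyz, hzx⟩
    · exact Or.inl rfl
    · exact Or.inr (Set.mem_biUnion (show z ∈ {z | N.Flow z x} from hzx) hyz)

/-- Places are never in conflict with themselves. -/
theorem not_conflict_self (hN : N.IsOccurrence) (p : P) :
    ¬ N.Conflict (Sum.inl p) (Sum.inl p) := by
  rintro ⟨q, -, -, t₁, t₂, hne, hq₁, hq₂, h₁, h₂⟩
  rcases Relation.ReflTransGen.cases_tail h₁ with h | ⟨r₁ | u₁, hu₁, hp₁⟩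
  · cases h
  · exact hp₁.elim
  rcases Relation.ReflTransGen.cases_tail h₂ with h | ⟨r₂ | u₂, hu₂, hp₂⟩
  · cases h
  · exact hp₂.elim
  obtain rfl := hN.unique_pre p u₁ u₂ hp₁ hp₂
  exact hN.no_self_conflict u₁
    ⟨q, Sum.inl_ne_inr, Sum.inl_ne_inr, t₁, t₂, hne, hq₁, hq₂, hu₁, hu₂⟩

/-- A transition of a finite nonempty set none of whose output places is consumed in that set. -/
theorem exists_mem_forall_post_notMem_pre (hN : N.IsOccurrence) {D : Finset T}
    (hD : D.Nonempty) : ∃ t ∈ D, ∀ t' ∈ D, ∀ p ∈ N.post t, p ∉ N.pre t' := by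
  let : Preorder T :=
    { le := fun a b => N.CLe (Sum.inr a) (Sum.inr b)
      le_refl := fun _ => Relation.ReflTransGen.refl
      le_trans := fun _ _ _ => Relation.ReflTransGen.trans }
  obtain ⟨t, ht, hmax⟩ := D.exists_maximal hD
  refine ⟨t, ht, fun t' ht' p hp hp' => ?_⟩
  have hpt' : N.Flow (Sum.inl p) (Sum.inr t') := hp'
  have htp : N.Flow (Sum.inr t) (Sum.inl p) := hp
  have hle : N.CLe (Sum.inr t) (Sum.inr t') := (Relation.ReflTransGen.single htp).tail hpt'
  have hge : N.CLe (Sum.inr t') (Sum.inr t) := hmax ht' hle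
  exact hN.not_cLe_of_flow htp (Relation.ReflTransGen.head hpt' hge)

/-- A finite causally closed and conflict-free set of transitions can be fired; every place that is
initial or produced by the set, and not consumed by it, is then marked. -/
theorem exists_reachable_of_configuration [DecidableEq P] (hN : N.IsOccurrence) (D : Finset T)
    (hclosed : ∀ t ∈ D, ∀ p ∈ N.pre t, ∀ t', p ∈ N.post t' → t' ∈ D)
    (hfree : ∀ t₁ ∈ D, ∀ t₂ ∈ D, ∀ p, p ∈ N.pre t₁ → p ∈ N.pre t₂ → t₁ = t₂) :
    ∃ M, N.Reachable M ∧
      ∀ p, (∀ t, p ∈ N.post t → t ∈ D) → (∀ t ∈ D, p ∉ N.pre t) → p ∈ M := by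
  classical
  induction D using Finset.strongInduction with
  | _ D ih =>
    rcases D.eq_empty_or_nonempty with rfl | hne
    · exact ⟨N.init, Relation.ReflTransGen.refl, fun p hp _ =>
        (hN.mem_init p).2 fun t ht => Finset.notMem_empty t (hp t ht)⟩
    obtain ⟨t, ht, hmax⟩ := hN.exists_mem_forall_post_notMem_pre hne
    have herase : ∀ p, (∀ t', p ∈ N.post t' → t' ∈ D) → p ∉ N.post t →
        ∀ t', p ∈ N.post t' → t' ∈ D.erase t := fun p hp hpt t' hpt' =>
      Finset.mem_erase.2 ⟨fun h => hpt (h ▸ hpt'), hp t' hpt'⟩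
    obtain ⟨M, hM, hmem⟩ := ih (D.erase t) (Finset.erase_ssubset ht)
      (fun t' ht' p hp => herase p (hclosed t' (Finset.mem_of_mem_erase ht') p hp)
        fun hpt => hmax t' (Finset.mem_of_mem_erase ht') p hpt hp)
      (fun t₁ h₁ t₂ h₂ => hfree t₁ (Finset.mem_of_mem_erase h₁) t₂ (Finset.mem_of_mem_erase h₂))
    have hle : N.pre t ≤ M := (Multiset.le_iff_subset (hN.pre_nodup t)).2 fun p hp =>
      hmem p (herase p (hclosed t ht p hp) fun hpt => hmax t ht p hpt hp) fun t' ht' hp' =>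
        Finset.ne_of_mem_erase ht' (hfree t' (Finset.mem_of_mem_erase ht') t ht p hp' hp)
    refine ⟨M - N.pre t + N.post t, hM.tail ⟨t, hle, rfl⟩, fun p hp hpre => ?_⟩
    rw [Multiset.mem_add]
    by_cases hpt : p ∈ N.post t
    · exact Or.inr hpt
    · refine Or.inl (Multiset.mem_sub.2 ?_)
      rw [Multiset.count_eq_zero_of_notMem (hpre t ht), Multiset.count_pos]
      exact hmem p (herase p hp hpt) fun t' ht' => hpre t' (Finset.mem_of_mem_erase ht')

end IsOccurrence

end PetriNet

/-- Every finite set of pairwise concurrent places of an occurrence net is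
contained in some reachable marking. -/
theorem pairwiseConcurrent_subset_reachable {P T : Type} [DecidableEq P]
    (N : PetriNet P T) (hN : N.IsOccurrence) (S : Set P) (hfin : S.Finite)
    (hconc : N.PairwiseConcurrent S) :
    ∃ M : Multiset P, N.Reachable M ∧ ∀ p ∈ S, p ∈ M := by
  classical
  have hflow {p q : P} {t : T} (hp : p ∈ N.pre t) (ht : N.CLe (Sum.inr t) (Sum.inl q)) :
      N.CLe (Sum.inl p) (Sum.inl q) :=
    Relation.ReflTransGen.head (show N.Flow (Sum.inl p) (Sum.inr t) from hp) ht
  have hne {p q : P} {t : T} (hp : p ∈ N.pre t) (ht : N.CLe (Sum.inr t) (Sum.inl q)) :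
      p ≠ q := by
    rintro rfl
    exact hN.not_cLe_of_flow (show N.Flow (Sum.inl p) (Sum.inr t) from hp) ht
  have hD : {t : T | ∃ s ∈ S, N.CLe (Sum.inr t) (Sum.inl s)}.Finite := by
    refine (hfin.biUnion fun s _ => (hN.finite_setOf_cLe (Sum.inl s)).preimage
      Sum.inr_injective.injOn).subset ?_
    rintro t ⟨s, hs, hts⟩
    exact Set.mem_biUnion hs hts
  obtain ⟨M, hM, hmem⟩ := hN.exists_reachable_of_configuration hD.toFinset
    (by
      simp only [Set.Finite.mem_toFinset, Set.mem_ofPred_eq]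
      rintro t ⟨s, hs, hts⟩ p hp t' hp'
      exact ⟨s, hs, Relation.ReflTransGen.head
        (show N.Flow (Sum.inr t') (Sum.inl p) from hp') (hflow hp hts)⟩)
    (by
      simp only [Set.Finite.mem_toFinset, Set.mem_ofPred_eq]
      rintro t₁ ⟨s₁, hs₁, h₁⟩ t₂ ⟨s₂, hs₂, h₂⟩ p hp₁ hp₂
      by_contra ht
      have hconf : N.Conflict (Sum.inl s₁) (Sum.inl s₂) :=
        ⟨p, Sum.inl_injective.ne (hne hp₁ h₁), Sum.inl_injective.ne (hne hp₂ h₂),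
          t₁, t₂, ht, hp₁, hp₂, h₁, h₂⟩
      by_cases hs : s₁ = s₂
      · subst hs
        exact hN.not_conflict_self s₁ hconf
      · exact (hconc s₁ hs₁ s₂ hs₂ hs).2.2 hconf)
  simp only [Set.Finite.mem_toFinset, Set.mem_ofPred_eq] at hmem
  refine ⟨M, hM, fun s hs => hmem s (fun t ht => ?_) ?_⟩
  · exact ⟨s, hs, Relation.ReflTransGen.single (show N.Flow (Sum.inr t) (Sum.inl s) from ht)⟩
  · rintro t ⟨s', hs', hts'⟩ hst
    exact (hconc s hs s' hs' (hne hst hts')).1 (hflow hst hts')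
end

section
/- Let (N^U, λ) be an initial branching process of a Petri net N. For every reachable marking M^U of N^U, the multiset image λ[M^U] is a reachable marking of N. -/
/-- In an initial branching process `(N₁, fP, fT)` of a net `N₂`, the image of
every reachable marking of `N₁` is a reachable marking of `N₂`. -/
theorem branchingProcess_reachable_image {P₁ T₁ P₂ T₂ : Type}
    [DecidableEq P₁] [DecidableEq P₂]
    (N₁ : PetriNet P₁ T₁) (N₂ : PetriNet P₂ T₂) (fP : P₁ → P₂) (fT : T₁ → T₂)
    (hbp : IsBranchingProcess N₁ N₂ fP fT)
    (M : Multiset P₁) (hM : N₁.Reachable M) :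
    N₂.Reachable (M.map fP) := by
  induction hM with
  | refl =>
    rw [hbp.map_init]
    exact Relation.ReflTransGen.refl
  | tail _ hstep ih =>
    obtain ⟨t, hle, rfl⟩ := hstep
    refine Relation.ReflTransGen.tail ih ⟨fT t, ?_, ?_⟩
    · rw [← hbp.map_pre]
      exact Multiset.map_le_map hle
    · obtain ⟨K, rfl⟩ := Multiset.le_iff_exists_add.mp hle
      rw [← hbp.map_pre, ← hbp.map_post]
      simp only [Multiset.map_add, add_tsub_cancel_left]
end

section
/- Let N be an occurrence net and x a place of N. Then the last known cut LKC(x) is a cut of N. -/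
/-- The last known cut of a place `x`:
`LKC(x) = {p | ¬(p < x) ∧ ∀ t ∈ pre(p), t < x}`. -/
def LKC {P T : Type} (N : PetriNet P T) (x : P) : Set P :=
  {p : P | ¬ N.CLt (Sum.inl p) (Sum.inl x) ∧
    ∀ t : T, p ∈ N.post t → N.CLt (Sum.inr t) (Sum.inl x)}

namespace PetriNet

variable {P T : Type}

/-- A nontrivial path into a place ends with a transition producing that place. -/
theorem CLt.exists_mem_post {N : PetriNet P T} {n : P ⊕ T} {p : P} (h : N.CLt n (Sum.inl p)) :
    ∃ t, N.CLe n (Sum.inr t) ∧ p ∈ N.post t := by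
  obtain ⟨m, hm, hmp⟩ := Relation.TransGen.tail'_iff.mp h
  cases m with
  | inl q => exact hmp.elim
  | inr t => exact ⟨t, hm, hmp⟩

/-- A nontrivial path out of a place starts with a transition consuming that place. -/
theorem CLt.exists_mem_pre {N : PetriNet P T} {n : P ⊕ T} {p : P} (h : N.CLt (Sum.inl p) n) :
    ∃ t, p ∈ N.pre t ∧ N.CLe (Sum.inr t) n := by
  obtain ⟨m, hpm, hm⟩ := Relation.TransGen.head'_iff.mp h
  cases m with
  | inl q => exact hpm.elim
  | inr t => exact ⟨t, hpm, hm⟩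

theorem CLe.clt_of_ne {N : PetriNet P T} {m n : P ⊕ T} (h : N.CLe m n) (hne : m ≠ n) :
    N.CLt m n :=
  (Relation.reflTransGen_iff_eq_or_transGen.mp h).resolve_left hne.symm

theorem IsOccurrence.not_clt_self_s14 {N : PetriNet P T} (hN : N.IsOccurrence) (n : P ⊕ T) :
    ¬ N.CLt n n :=
  fun h => hN.wf.transGen.irrefl.irrefl n h

theorem IsOccurrence.ne_of_clt_s14 {N : PetriNet P T} (hN : N.IsOccurrence) {m n : P ⊕ T}
    (h : N.CLt m n) : m ≠ n := by
  rintro rfl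
  exact hN.not_clt_self_s14 _ h

theorem clt_of_mem_pre {N : PetriNet P T} {p : P} {t : T} {n : P ⊕ T} (hp : p ∈ N.pre t)
    (h : N.CLe (Sum.inr t) n) : N.CLt (Sum.inl p) n :=
  Relation.TransGen.head' (show N.Flow (Sum.inl p) (Sum.inr t) from hp) h

/-- Everything strictly below a member of the last known cut of `x` is strictly below `x`. -/
theorem clt_of_clt_of_mem_lkc {N : PetriNet P T} {x p : P} (hp : p ∈ LKC N x) {n : P ⊕ T}
    (h : N.CLt n (Sum.inl p)) : N.CLt n (Sum.inl x) := by
  obtain ⟨t, hnt, htp⟩ := h.exists_mem_post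
  exact Relation.TransGen.trans_right hnt (hp.2 t htp)

theorem IsOccurrence.mem_lkc_self {N : PetriNet P T} (hN : N.IsOccurrence) (x : P) :
    x ∈ LKC N x :=
  ⟨hN.not_clt_self_s14 _, fun t ht =>
    Relation.TransGen.single (show N.Flow (Sum.inr t) (Sum.inl x) from ht)⟩

/-- Distinct transitions sharing an input place cannot both precede the same place. -/
theorem IsOccurrence.eq_of_clt_of_clt {N : PetriNet P T} (hN : N.IsOccurrence) {x c : P}
    {t₁ t₂ : T} (h₁ : c ∈ N.pre t₁) (h₂ : c ∈ N.pre t₂) (hx₁ : N.CLt (Sum.inr t₁) (Sum.inl x))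
    (hx₂ : N.CLt (Sum.inr t₂) (Sum.inl x)) : t₁ = t₂ := by
  by_contra hne
  obtain ⟨u, hu₁, hxu⟩ := hx₁.exists_mem_post
  obtain ⟨v, hv₂, hxv⟩ := hx₂.exists_mem_post
  obtain rfl := hN.unique_pre x u v hxu hxv
  exact hN.no_self_conflict u
    ⟨c, Sum.inl_ne_inr, Sum.inl_ne_inr, t₁, t₂, hne, h₁, h₂, hu₁, hv₂⟩

theorem IsOccurrence.pairwiseConcurrent_lkc {N : PetriNet P T} (hN : N.IsOccurrence) (x : P) :
    N.PairwiseConcurrent (LKC N x) := by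
  intro p hp q hq hpq
  refine ⟨fun h => ?_, fun h => ?_, ?_⟩
  · exact hp.1 (clt_of_clt_of_mem_lkc hq (h.clt_of_ne (by simpa using hpq)))
  · exact hq.1 (clt_of_clt_of_mem_lkc hp (h.clt_of_ne (by simpa using hpq.symm)))
  · rintro ⟨c, -, -, t₁, t₂, hne, h₁, h₂, hp₁, hq₂⟩
    exact hne (hN.eq_of_clt_of_clt h₁ h₂
      (clt_of_clt_of_mem_lkc hp (hp₁.clt_of_ne Sum.inr_ne_inl))
      (clt_of_clt_of_mem_lkc hq (hq₂.clt_of_ne Sum.inr_ne_inl)))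

/-- A place that is not in the strict past of `x` lies above a member of the last known cut
of `x` or is in conflict with `x`. -/
theorem IsOccurrence.exists_mem_lkc_cle_or_conflict {N : PetriNet P T} (hN : N.IsOccurrence)
    {x p : P} (hp : ¬ N.CLt (Sum.inl p) (Sum.inl x)) :
    (∃ q ∈ LKC N x, N.CLe (Sum.inl q) (Sum.inl p)) ∨ N.Conflict (Sum.inl p) (Sum.inl x) := by
  have key : ∀ n : P ⊕ T, ∀ p, n = Sum.inl p → ¬ N.CLt (Sum.inl p) (Sum.inl x) →
      (∃ q ∈ LKC N x, N.CLe (Sum.inl q) (Sum.inl p)) ∨ N.Conflict (Sum.inl p) (Sum.inl x) := by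
    intro n
    induction n using hN.wf.transGen.induction with
    | _ n ih =>
    rintro p rfl hp
    by_cases hmem : p ∈ LKC N x
    · exact Or.inl ⟨p, hmem, Relation.ReflTransGen.refl⟩
    obtain ⟨t, htp, htx⟩ : ∃ t, p ∈ N.post t ∧ ¬ N.CLt (Sum.inr t) (Sum.inl x) := by
      by_contra! h
      exact hmem ⟨hp, h⟩
    have htp' : N.CLe (Sum.inr t) (Sum.inl p) :=
      Relation.ReflTransGen.single (show N.Flow (Sum.inr t) (Sum.inl p) from htp)
    obtain ⟨r, hr⟩ := Multiset.exists_mem_of_ne_zero (N.pre_ne t)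
    have hrp : N.CLt (Sum.inl r) (Sum.inl p) := clt_of_mem_pre hr htp'
    by_cases hrx : N.CLt (Sum.inl r) (Sum.inl x)
    · obtain ⟨u, hru, hux⟩ := hrx.exists_mem_pre
      refine Or.inr ⟨r, hN.ne_of_clt_s14 hrp, hN.ne_of_clt_s14 hrx, t, u, ?_, hr, hru, htp', hux⟩
      rintro rfl
      exact htx (hux.clt_of_ne Sum.inr_ne_inl)
    · rcases ih _ hrp r rfl hrx with ⟨q, hq, hqr⟩ | ⟨c, -, hcx, t₁, t₂, hne, h₁, h₂, hr₁, hx₂⟩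
      · exact Or.inl ⟨q, hq, hqr.trans hrp.to_reflTransGen⟩
      · have hp₁ : N.CLe (Sum.inr t₁) (Sum.inl p) := hr₁.trans hrp.to_reflTransGen
        exact Or.inr ⟨c, hN.ne_of_clt_s14 (clt_of_mem_pre h₁ hp₁), hcx, t₁, t₂, hne, h₁, h₂, hp₁, hx₂⟩
  exact key _ p rfl hp

end PetriNet

/-- In an occurrence net, the last known cut of any place is a cut. -/
theorem lkc_isCut {P T : Type} (N : PetriNet P T) (hN : N.IsOccurrence) (x : P) :
    N.IsCut (LKC N x) := by
  refine ⟨hN.pairwiseConcurrent_lkc x, fun D hD hsub => Set.Subset.antisymm (fun d hd => ?_) hsub⟩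
  by_contra hmem
  have hne : ∀ q ∈ LKC N x, d ≠ q := fun q hq h => hmem (h ▸ hq)
  have hx := hN.mem_lkc_self x
  have hdx := hD d hd x (hsub hx) (hne x hx)
  rcases hN.exists_mem_lkc_cle_or_conflict (fun h => hdx.1 h.to_reflTransGen) with
    ⟨q, hq, hqd⟩ | hconf
  · exact (hD d hd q (hsub hq) (hne q hq)).2.1 hqd
  · exact hdx.2.2 hconf
end

section
/- Let C be a cut in an occurrence net N and c ∈ C. Then LKC(c) ⊆ past(C). -/
namespace PetriNet

variable {P T : Type} {N : PetriNet P T}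

theorem IsOccurrence.not_cLt_self (hN : N.IsOccurrence) (x : P ⊕ T) : ¬ N.CLt x x :=
  fun h => hN.wf.transGen.irrefl.irrefl x h

/-- Any node strictly below a place is below a transition producing that place. -/
theorem exists_mem_post_of_cLe {x : P ⊕ T} {p : P} (h : N.CLe x (Sum.inl p))
    (hne : x ≠ Sum.inl p) : ∃ t, p ∈ N.post t ∧ N.CLe x (Sum.inr t) := by
  rcases Relation.ReflTransGen.cases_tail h with heq | ⟨y, hxy, hyp⟩
  · exact absurd heq.symm hne
  · rcases y with q | t
    · exact hyp.elim
    · exact ⟨t, hyp, hxy⟩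

/-- Two distinct transitions consuming a common place have no common place above them. -/
theorem IsOccurrence.false_of_cLe_place (hN : N.IsOccurrence) {q c : P} {t₁ t₂ : T}
    (hne : t₁ ≠ t₂) (hq₁ : q ∈ N.pre t₁) (hq₂ : q ∈ N.pre t₂)
    (h₁ : N.CLe (Sum.inr t₁) (Sum.inl c)) (h₂ : N.CLe (Sum.inr t₂) (Sum.inl c)) : False := by
  obtain ⟨t, ht, hle₁⟩ := exists_mem_post_of_cLe h₁ Sum.inr_ne_inl
  obtain ⟨t', ht', hle₂⟩ := exists_mem_post_of_cLe h₂ Sum.inr_ne_inl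
  obtain rfl := hN.unique_pre c t t' ht ht'
  exact hN.no_self_conflict t
    ⟨q, Sum.inl_ne_inr, Sum.inl_ne_inr, t₁, t₂, hne, hq₁, hq₂, hle₁, hle₂⟩

/-- A place outside a cut is not concurrent with some element of the cut. -/
theorem IsCut.exists_not_concurrent {C : Set P} (hC : N.IsCut C) {p : P} (hp : p ∉ C) :
    ∃ d ∈ C, ¬ N.Concurrent (Sum.inl p) (Sum.inl d) := by
  by_contra! h
  have hD : N.PairwiseConcurrent (insert p C) := by
    rintro a (rfl | ha) b (rfl | hb) hab
    · exact absurd rfl hab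
    · exact h b hb
    · exact (h a ha).symm
    · exact hC.1 a ha b hb hab
  exact hp (hC.2 _ hD (Set.subset_insert p C) ▸ Set.mem_insert p C)

/-- Any node strictly below a place of the last known cut of `c` is strictly below `c`. -/
theorem cLt_of_cLe_mem_LKC {c p : P} (hp : p ∈ LKC N c) {x : P ⊕ T}
    (h : N.CLe x (Sum.inl p)) (hne : x ≠ Sum.inl p) : N.CLt x (Sum.inl c) := by
  obtain ⟨t, ht, hxt⟩ := exists_mem_post_of_cLe h hne
  exact Relation.TransGen.trans_right hxt (hp.2 t ht)

end PetriNet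

/-- If `C` is a cut of an occurrence net and `c ∈ C`, then
`LKC(c) ⊆ past(C)`. -/
theorem lkc_subset_past {P T : Type} (N : PetriNet P T) (hN : N.IsOccurrence)
    (C : Set P) (hC : N.IsCut C) (c : P) (hc : c ∈ C) :
    ∀ p ∈ LKC N c, ∃ d ∈ C, N.CLe (Sum.inl p) (Sum.inl d) := by
  intro p hp
  by_contra! h
  have hpC : p ∉ C := fun hpC => h p hpC .refl
  obtain ⟨d, hd, hpd⟩ := hC.exists_not_concurrent hpC
  refine hpd ⟨h d hd, fun hle => ?_, ?_⟩
  · have hlt := PetriNet.cLt_of_cLe_mem_LKC hp hle fun heq => hpC (Sum.inl.inj heq ▸ hd)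
    have hdc : d ≠ c := by
      rintro rfl
      exact hN.not_cLt_self _ hlt
    exact (hC.1 d hd c hc hdc).1 hlt.to_reflTransGen
  · rintro ⟨q, -, hqd, t₁, t₂, hne, hq₁, hq₂, hle₁, hle₂⟩
    have hlt := PetriNet.cLt_of_cLe_mem_LKC hp hle₁ Sum.inr_ne_inl
    by_cases hcd : c = d
    · subst hcd
      exact hN.false_of_cLe_place hne hq₁ hq₂ hlt.to_reflTransGen hle₂
    · refine (hC.1 c hc d hd hcd).2.2
        ⟨q, fun hqc => ?_, hqd, t₁, t₂, hne, hq₁, hq₂, hlt.to_reflTransGen, hle₂⟩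
      have hqt : N.Flow (Sum.inl q) (Sum.inr t₁) := hq₁
      exact hN.not_cLt_self _ (hqc ▸ hlt.head hqt)
end
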